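/- arXiv:2409.09100 — 2 statements merged into one kernel-verified Lean document; each statement's English description precedes it below -/
import Mathlib

section
/- Fix reals P ∈ (0,1], σ > 0, E > 0 and d > 0, and define f(x) = (√(x P σ²) + d) / ((x-1) P E + d) for real x ≥ 1. Then f is strictly decreasing on the interval [max(1, σ²/(4PE²)), ∞); that is, for all x₁ < x₂ in this interval, f(x₁) > f(x₂). (Hence, by Corollary 1 of the paper, the convergence rate r = -log f(n) is strictly increasing in the population size n for large n.) -/
/-- The spectral-radius estimate f(x) = (√(xPσ²)+d)/((x-1)PE+d) of Theorem 1 is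
strictly decreasing on [max(1, σ²/(4PE²)), ∞), so the convergence rate r = -log f(n)
is strictly increasing in the population size n for large n. -/
theorem stmt_6 (P σ E d : ℝ) (hP : 0 < P) (hP1 : P ≤ 1) (hσ : 0 < σ) (hE : 0 < E)
    (hd : 0 < d) :
    StrictAntiOn (fun x : ℝ => (Real.sqrt (x * P * σ ^ 2) + d) / ((x - 1) * P * E + d))
      (Set.Ici (max 1 (σ ^ 2 / (4 * P * E ^ 2)))) := by
  intro x hx y hy hxy
  simp only [Set.mem_Ici, max_le_iff] at hx hy
  obtain ⟨hx1, hx2⟩ := hx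
  have hy1 := hy.1
  have hx0 : 0 < x := by linarith
  have hy0 : 0 < y := by linarith
  have hDx : 0 < (x - 1) * P * E + d := by
    have : 0 ≤ (x - 1) * P * E := by
      have : 0 ≤ x - 1 := by linarith
      positivity
    linarith
  have hDy : 0 < (y - 1) * P * E + d := by
    have : 0 ≤ (y - 1) * P * E := by
      have : 0 ≤ y - 1 := by linarith
      positivity
    linarith
  have ha2 : Real.sqrt (x * P * σ ^ 2) ^ 2 = x * P * σ ^ 2 := Real.sq_sqrt (by positivity)
  have hb2 : Real.sqrt (y * P * σ ^ 2) ^ 2 = y * P * σ ^ 2 := Real.sq_sqrt (by positivity)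
  have hab : Real.sqrt (x * P * σ ^ 2) < Real.sqrt (y * P * σ ^ 2) :=
    Real.sqrt_lt_sqrt (by positivity) (by gcongr)
  have hk : σ ^ 2 / (2 * E) ≤ Real.sqrt (x * P * σ ^ 2) := by
    apply Real.le_sqrt_of_sq_le
    calc (σ ^ 2 / (2 * E)) ^ 2 = (σ ^ 2 / (4 * P * E ^ 2)) * P * σ ^ 2 := by
          field_simp; norm_num
      _ ≤ _ := by gcongr
  rw [div_le_iff₀ (by positivity)] at hk
  have ha0 : 0 < Real.sqrt (x * P * σ ^ 2) := by positivity
  show _ / _ < _ / _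
  rw [div_lt_div_iff₀ hDy hDx]
  generalize Real.sqrt (x * P * σ ^ 2) = a at *
  generalize Real.sqrt (y * P * σ ^ 2) = b at *
  have hb0 : 0 < b := ha0.trans hab
  have hs : 0 < σ ^ 2 := by positivity
  have key : 0 < (b - a) * (E * a * b + P * E * σ ^ 2 + d * (E * (a + b) - σ ^ 2)) := by
    have h1 : 0 < b - a := by linarith
    have h2 : 0 < E * (a + b) - σ ^ 2 := by nlinarith
    positivity
  have e : (b - a) * (E * a * b + P * E * σ ^ 2 + d * (E * (a + b) - σ ^ 2))
      = σ ^ 2 * ((a + d) * ((y - 1) * P * E + d) - (b + d) * ((x - 1) * P * E + d)) := by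
    linear_combination (a + d) * E * hb2 - (b + d) * E * ha2
  rw [e] at key
  have := (mul_pos_iff_of_pos_left hs).1 key
  linarith
end

section
/- Let n ≥ 2 and P, E, σ be positive reals, and define G(d) = (nP(σ² + E²)² + σ²d²) / (σ²((n-1)PE + d)²). Then G is strictly increasing on the interval (n(σ² + E²)²/((n-1)σ²E), ∞); that is, for n(σ²+E²)²/((n-1)σ²E) < d₁ < d₂ one has G(d₁) < G(d₂). (Hence for the trust/mistrust (+/ -) scenario, under the lower bound on the self-confidence level from Assumption 2, a higher d increases the estimate Δ₂² of the dominant eigenvalue modulus squared.) -/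
/-- Theorem 3, trust/mistrust (plus/minus) scenario, Δ₂²: the function
G(d) = (nP(σ²+E²)² + σ²d²)/(σ²((n-1)PE+d)²) is strictly increasing on
(n(σ²+E²)²/((n-1)σ²E), ∞). -/
theorem stmt_12 (n P E σ : ℝ) (hn : 2 ≤ n) (hP : 0 < P) (hE : 0 < E) (hσ : 0 < σ) :
    StrictMonoOn
      (fun d : ℝ => (n * P * (σ ^ 2 + E ^ 2) ^ 2 + σ ^ 2 * d ^ 2) /
        (σ ^ 2 * ((n - 1) * P * E + d) ^ 2))
      (Set.Ioi (n * (σ ^ 2 + E ^ 2) ^ 2 / ((n - 1) * σ ^ 2 * E))) := by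
  have hn1 : 0 < n - 1 := by linarith
  have hs : 0 < σ ^ 2 := by positivity
  have key : ∀ d : ℝ, n * (σ ^ 2 + E ^ 2) ^ 2 / ((n - 1) * σ ^ 2 * E) < d →
      0 < d ∧ n * P * (σ ^ 2 + E ^ 2) ^ 2 < σ ^ 2 * ((n - 1) * P * E) * d := by
    intro d hd
    have hn0 : 0 < n := by linarith
    refine ⟨lt_trans (by positivity) hd, ?_⟩
    rw [div_lt_iff₀ (by positivity)] at hd
    have := mul_lt_mul_of_pos_left hd hP
    linarith
  intro a ha b hb hab
  obtain ⟨ha0, hA⟩ := key a ha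
  obtain ⟨hb0, hB⟩ := key b hb
  have hc : 0 < (n - 1) * P * E := by positivity
  simp only
  generalize (n - 1) * P * E = c at *
  generalize n * P * (σ ^ 2 + E ^ 2) ^ 2 = A at *
  generalize σ ^ 2 = s at *
  rw [div_lt_div_iff₀ (by positivity) (by positivity)]
  have h1 := mul_lt_mul_of_pos_right hA hc
  have h2 := mul_lt_mul_of_pos_right hB hc
  have h3 := mul_lt_mul_of_pos_right hA hb0
  have h4 := mul_lt_mul_of_pos_right hB ha0
  have h5 : 0 < s * c * (b * c + a * c + 2 * a * b) - A * (2 * c + a + b) := by linarith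
  have h6 := mul_pos (mul_pos hs (sub_pos.2 hab)) h5
  linarith
end
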